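/- arXiv:1907.13273 — 2 statements merged into one kernel-verified Lean document; each statement's English description precedes it below -/
import Mathlib

section
/- (Proposition 4.2, curvature part.) Let α be a smooth curve in the Galilean 3-space G₃ parametrized by Galilean arc length, with Galilean Frenet frame {T, N, B}, curvature κ and torsion τ, and let φ(s,t) = α(s) + tB(s) be the binormal surface along α. Then the Gaussian curvature of φ satisfies K(s,t) = −τ(s)² for all (s,t) ∈ I × ℝ; in particular K ≤ 0 everywhere, so the binormal surface along a geodesic is either a surface of negative curvature or flat. -/
noncomputable section

/-- The Galilean cross product of two vectors in `G₃` (modeled on `Fin 3 → ℝ`):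
`x ∧ y = (0, x₃y₁ − x₁y₃, x₁y₂ − x₂y₁)`. -/
def gcross (x y : Fin 3 → ℝ) : Fin 3 → ℝ :=
  ![0, x 2 * y 0 - x 0 * y 2, x 0 * y 1 - x 1 * y 0]

/-- The Galilean scalar product of two isotropic vectors: the Euclidean dot product
of their last two components. -/
def gdot (x y : Fin 3 → ℝ) : ℝ := x 1 * y 1 + x 2 * y 2

/-- The Galilean norm of an isotropic vector. -/
def gnorm (x : Fin 3 → ℝ) : ℝ := Real.sqrt (gdot x x)

/-- Partial derivative of a parametrized surface with respect to the first parameter. -/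
def pderivS (φ : ℝ → ℝ → (Fin 3 → ℝ)) (s t : ℝ) : Fin 3 → ℝ :=
  deriv (fun u => φ u t) s

/-- Partial derivative of a parametrized surface with respect to the second parameter. -/
def pderivT (φ : ℝ → ℝ → (Fin 3 → ℝ)) (s t : ℝ) : Fin 3 → ℝ :=
  deriv (fun v => φ s v) t

/-- `w = ‖φ_s ∧ φ_t‖`, the Galilean norm of the cross product of the partials. -/
def wfun (φ : ℝ → ℝ → (Fin 3 → ℝ)) (s t : ℝ) : ℝ :=
  gnorm (gcross (pderivS φ s t) (pderivT φ s t))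

/-- The unit isotropic normal `η = (φ_s ∧ φ_t)/w` of the surface `φ`. -/
def unitNormal (φ : ℝ → ℝ → (Fin 3 → ℝ)) (s t : ℝ) : Fin 3 → ℝ :=
  (wfun φ s t)⁻¹ • gcross (pderivS φ s t) (pderivT φ s t)

/-- Second fundamental form coefficient `L₁₁ = ⟨φ_ss, η⟩`. -/
def L11 (φ : ℝ → ℝ → (Fin 3 → ℝ)) (s t : ℝ) : ℝ :=
  gdot (pderivS (pderivS φ) s t) (unitNormal φ s t)

/-- Second fundamental form coefficient `L₁₂ = ⟨φ_st, η⟩`. -/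
def L12 (φ : ℝ → ℝ → (Fin 3 → ℝ)) (s t : ℝ) : ℝ :=
  gdot (pderivS (pderivT φ) s t) (unitNormal φ s t)

/-- Second fundamental form coefficient `L₂₂ = ⟨φ_tt, η⟩`. -/
def L22 (φ : ℝ → ℝ → (Fin 3 → ℝ)) (s t : ℝ) : ℝ :=
  gdot (pderivT (pderivT φ) s t) (unitNormal φ s t)

/-- Gaussian curvature `K = (L₁₁L₂₂ − L₁₂²)/w²`. -/
def Kgauss (φ : ℝ → ℝ → (Fin 3 → ℝ)) (s t : ℝ) : ℝ :=
  (L11 φ s t * L22 φ s t - (L12 φ s t) ^ 2) / (wfun φ s t) ^ 2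

/-- Mean curvature of the ruled surface `φ` (with `g₁ = 1`, `g₂ = 0`): `H = L₂₂/(2w²)`. -/
def Hmean (φ : ℝ → ℝ → (Fin 3 → ℝ)) (s t : ℝ) : ℝ :=
  L22 φ s t / (2 * (wfun φ s t) ^ 2)

theorem deriv_coord_zero_eq_one {I : Set ℝ} (hI : IsOpen I) {α : ℝ → (Fin 3 → ℝ)}
    {v : Fin 3 → ℝ} {s : ℝ} (hs : s ∈ I) (hα0 : ∀ u ∈ I, α u 0 = u)
    (hα : HasDerivAt α v s) : v 0 = 1 := by
  have hcoord : HasDerivAt (fun u => α u 0) (v 0) s := hasDerivAt_pi.1 hα 0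
  have heq : (fun u => α u 0) =ᶠ[nhds s] id :=
    Filter.eventually_of_mem (hI.mem_nhds hs) hα0
  exact hcoord.unique ((hasDerivAt_id s).congr_of_eventuallyEq heq)

theorem pderivT_ruled {φ : ℝ → ℝ → (Fin 3 → ℝ)} {α B : ℝ → (Fin 3 → ℝ)}
    (hφ : ∀ s t : ℝ, φ s t = α s + t • B s) (s t : ℝ) : pderivT φ s t = B s := by
  have h : HasDerivAt (fun v : ℝ => α s + v • B s) ((1 : ℝ) • B s) t :=
    ((hasDerivAt_id t).smul_const (B s)).const_add (α s)
  simpa [pderivT, hφ] using h.deriv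

theorem pderivS_ruled {φ : ℝ → ℝ → (Fin 3 → ℝ)} {α B : ℝ → (Fin 3 → ℝ)}
    (hφ : ∀ s t : ℝ, φ s t = α s + t • B s) {s : ℝ} {a b : Fin 3 → ℝ}
    (hα : HasDerivAt α a s) (hB : HasDerivAt B b s) (t : ℝ) :
    pderivS φ s t = a + t • b := by
  have h : HasDerivAt (fun u : ℝ => α u + t • B u) (a + t • b) s :=
    hα.add (hB.const_smul t)
  simpa only [pderivS, hφ] using h.deriv

theorem pderivT_pderivT_ruled {φ : ℝ → ℝ → (Fin 3 → ℝ)} {α B : ℝ → (Fin 3 → ℝ)}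
    (hφ : ∀ s t : ℝ, φ s t = α s + t • B s) (s t : ℝ) :
    pderivT (pderivT φ) s t = 0 := by
  have h : pderivT φ = fun s _ => B s := funext₂ (pderivT_ruled hφ)
  rw [h]
  exact deriv_const t (B s)

theorem pderivS_pderivT_ruled {φ : ℝ → ℝ → (Fin 3 → ℝ)} {α B : ℝ → (Fin 3 → ℝ)}
    (hφ : ∀ s t : ℝ, φ s t = α s + t • B s) {s : ℝ} {b : Fin 3 → ℝ}
    (hB : HasDerivAt B b s) (t : ℝ) : pderivS (pderivT φ) s t = b := by
  have h : pderivT φ = fun s _ => B s := funext₂ (pderivT_ruled hφ)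
  simpa only [h, pderivS] using hB.deriv

theorem gcross_tangent_binormal {T N : Fin 3 → ℝ} (hT : T 0 = 1) (hN : N 0 = 0) (c : ℝ) :
    gcross (T + c • N) (gcross T N) = -N := by
  ext i
  fin_cases i <;> simp [gcross, hT, hN]

theorem binormal_surface_gaussian_curvature
    (I : Set ℝ) (hI : ∃ a b : ℝ, I = Set.Ioo a b)
    (α T N B : ℝ → (Fin 3 → ℝ)) (κ τ : ℝ → ℝ)
    (hαsm : ContDiffOn ℝ (⊤ : ℕ∞) α I) (hNsm : ContDiffOn ℝ (⊤ : ℕ∞) N I) (hBsm : ContDiffOn ℝ (⊤ : ℕ∞) B I)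
    (hκsm : ContDiffOn ℝ (⊤ : ℕ∞) κ I) (hτsm : ContDiffOn ℝ (⊤ : ℕ∞) τ I)
    (hα0 : ∀ s ∈ I, α s 0 = s)
    (hT : ∀ s ∈ I, HasDerivAt α (T s) s)
    (hNiso : ∀ s ∈ I, N s 0 = 0) (hBiso : ∀ s ∈ I, B s 0 = 0)
    (hNunit : ∀ s ∈ I, gdot (N s) (N s) = 1) (hBunit : ∀ s ∈ I, gdot (B s) (B s) = 1)
    (hNB : ∀ s ∈ I, gdot (N s) (B s) = 0)
    (hBdef : ∀ s ∈ I, B s = gcross (T s) (N s))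
    (hFrenetT : ∀ s ∈ I, HasDerivAt T (κ s • N s) s)
    (hFrenetN : ∀ s ∈ I, HasDerivAt N (τ s • B s) s)
    (hFrenetB : ∀ s ∈ I, HasDerivAt B ((-τ s) • N s) s)
    (φ : ℝ → ℝ → (Fin 3 → ℝ)) (hφ : ∀ s t : ℝ, φ s t = α s + t • B s)
    :
    ∀ s ∈ I, ∀ t : ℝ,
      Kgauss φ s t = -(τ s) ^ 2 ∧ Kgauss φ s t ≤ 0 := by
  intro s hs t
  have hIo : IsOpen I := by
    obtain ⟨a, b, rfl⟩ := hI
    exact isOpen_Ioo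
  have hT0 : T s 0 = 1 := deriv_coord_zero_eq_one hIo hs hα0 (hT s hs)
  have hcross : gcross (pderivS φ s t) (pderivT φ s t) = -N s := by
    rw [pderivS_ruled hφ (hT s hs) (hFrenetB s hs), pderivT_ruled hφ, hBdef s hs, smul_smul]
    exact gcross_tangent_binormal hT0 (hNiso s hs) _
  have hN : N s 1 * N s 1 + N s 2 * N s 2 = 1 := hNunit s hs
  have hw : wfun φ s t = 1 := by
    simp [wfun, hcross, gnorm, gdot, hN]
  have hη : unitNormal φ s t = -N s := by
    simp [unitNormal, hw, hcross]
  have h22 : L22 φ s t = 0 := by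
    simp [L22, pderivT_pderivT_ruled hφ, gdot]
  have h12 : L12 φ s t = τ s := by
    rw [L12, pderivS_pderivT_ruled hφ (hFrenetB s hs), hη]
    simp only [gdot, Pi.smul_apply, Pi.neg_apply, smul_eq_mul]
    linear_combination τ s * hN
  have hK : Kgauss φ s t = -(τ s) ^ 2 := by
    simp [Kgauss, h22, h12, hw]
  exact ⟨hK, hK ▸ neg_nonpos.2 (sq_nonneg _)⟩

end
end

section
/- (Lemma 4.3, case (ii).) Let α be a smooth curve in the Galilean 3-space G₃ parametrized by Galilean arc length, with Galilean Frenet frame {T, N, B}, curvature κ and torsion τ, and let φ(s,t) = α(s) + tB(s) be the binormal surface along α. If the Gaussian curvature of φ vanishes identically, K(s,t) = 0 for all (s,t) ∈ I × ℝ, then τ(s) = 0 for all s ∈ I, i.e. α is a planar curve. -/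
noncomputable section

/-- The `t`-derivative of a ruled surface is its director. -/
theorem pderivT_ruled_s13 (c d : ℝ → (Fin 3 → ℝ)) :
    pderivT (fun s t => c s + t • d s) = fun s _ => d s := by
  funext s t
  have h : HasDerivAt (fun v : ℝ => c s + v • d s) ((1 : ℝ) • d s) t :=
    ((hasDerivAt_id t).smul_const (d s)).const_add (c s)
  simpa [pderivT] using h.deriv

/-- A ruled surface has `L₂₂ = 0`. -/
theorem L22_ruled (c d : ℝ → (Fin 3 → ℝ)) (s t : ℝ) :
    L22 (fun s t => c s + t • d s) s t = 0 := by
  rw [L22, pderivT_ruled_s13]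
  simp [pderivT, gdot]

theorem binormal_surface_flat_planar
    (I : Set ℝ) (hI : ∃ a b : ℝ, I = Set.Ioo a b)
    (α T N B : ℝ → (Fin 3 → ℝ)) (κ τ : ℝ → ℝ)
    (hαsm : ContDiffOn ℝ (⊤ : ℕ∞) α I) (hNsm : ContDiffOn ℝ (⊤ : ℕ∞) N I) (hBsm : ContDiffOn ℝ (⊤ : ℕ∞) B I)
    (hκsm : ContDiffOn ℝ (⊤ : ℕ∞) κ I) (hτsm : ContDiffOn ℝ (⊤ : ℕ∞) τ I)
    (hα0 : ∀ s ∈ I, α s 0 = s)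
    (hT : ∀ s ∈ I, HasDerivAt α (T s) s)
    (hNiso : ∀ s ∈ I, N s 0 = 0) (hBiso : ∀ s ∈ I, B s 0 = 0)
    (hNunit : ∀ s ∈ I, gdot (N s) (N s) = 1) (hBunit : ∀ s ∈ I, gdot (B s) (B s) = 1)
    (hNB : ∀ s ∈ I, gdot (N s) (B s) = 0)
    (hBdef : ∀ s ∈ I, B s = gcross (T s) (N s))
    (hFrenetT : ∀ s ∈ I, HasDerivAt T (κ s • N s) s)
    (hFrenetN : ∀ s ∈ I, HasDerivAt N (τ s • B s) s)
    (hFrenetB : ∀ s ∈ I, HasDerivAt B ((-τ s) • N s) s)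
    (φ : ℝ → ℝ → (Fin 3 → ℝ)) (hφ : ∀ s t : ℝ, φ s t = α s + t • B s)
    (hK : ∀ s ∈ I, ∀ t : ℝ, Kgauss φ s t = 0) :
    ∀ s ∈ I, τ s = 0 := by
  obtain ⟨a, b, rfl⟩ := hI
  intro s hs
  obtain rfl : φ = fun s t => α s + t • B s := by
    funext s t
    exact hφ s t
  have hT0 : T s 0 = 1 := by
    have h : HasDerivAt (fun u => α u 0) (T s 0) s := hasDerivAt_pi.1 (hT s hs) 0
    refine h.unique ((hasDerivAt_id s).congr_of_eventuallyEq ?_)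
    filter_upwards [isOpen_Ioo.mem_nhds hs] with u hu using hα0 u hu
  have hφs : pderivS (fun s t => α s + t • B s) s 0 = T s := by
    simpa [pderivS] using (hT s hs).deriv
  have hφst : pderivS (fun s _ => B s) s 0 = (-τ s) • N s := (hFrenetB s hs).deriv
  have hB1 : B s 1 = -N s 2 := by
    rw [hBdef s hs]
    simp [gcross, hT0, hNiso s hs]
  have hB2 : B s 2 = N s 1 := by
    rw [hBdef s hs]
    simp [gcross, hT0, hNiso s hs]
  have hcross : gcross (T s) (B s) = -N s := by
    funext i
    fin_cases i <;> simp [gcross, hT0, hNiso s hs, hBiso s hs, hB1, hB2]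
  have hN := hNunit s hs
  have hw : wfun (fun s t => α s + t • B s) s 0 = 1 := by
    rw [wfun, hφs, pderivT_ruled_s13, hcross, gnorm, Real.sqrt_eq_one, ← hN]
    simp [gdot]
  have hL12 : L12 (fun s t => α s + t • B s) s 0 = τ s := by
    rw [L12, unitNormal, hw, hφs, pderivT_ruled_s13, hφst, hcross]
    simp only [gdot, Pi.smul_apply, Pi.neg_apply, smul_eq_mul] at hN ⊢
    linear_combination τ s * hN
  have hK0 := hK s hs 0
  simpa [Kgauss, L22_ruled, hL12, hw] using hK0

end
end
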